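/- Let 𝒢 = (G_1,…,G_k) be a connected sunflower proper interval graph with shared graph S and simultaneous enumeration (σ_1,…,σ_k). Then for any simultaneous enumeration (σ'_1,…,σ'_k) of 𝒢, each straight enumeration σ'_i can be obtained from σ_i or from the reversal σ_i^r through reversal of loose components of G_i. -/

import Mathlib

/-!
Common definitions: graphs on a vertex subset, (proper/unit) interval
representations, blocks, straight enumerations, sunflower graphs,
simultaneous enumerations, components, chains/bars, etc.
-/

universe u

/-- A finite simple graph on a subset `verts` of an ambient vertex type `V`. -/
structure GraphOn (V : Type u) where
  verts : Set V
  Adj : V → V → Prop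
  symm : ∀ {u v}, Adj u v → Adj v u
  loopless : ∀ v, ¬ Adj v v
  mem_of_adj : ∀ {u v}, Adj u v → u ∈ verts ∧ v ∈ verts

namespace GraphOn

variable {V : Type u}

/-- The closed real interval assigned to vertex `v` by the endpoint map `I`. -/
def ivl (I : V → ℝ × ℝ) (v : V) : Set ℝ := Set.Icc (I v).1 (I v).2

/-- `I` is an interval representation of `G`: each vertex gets a (nonempty) closed
interval and intervals of distinct vertices intersect iff the vertices are adjacent. -/
def IsRep (G : GraphOn V) (I : V → ℝ × ℝ) : Prop :=
  (∀ v ∈ G.verts, (I v).1 ≤ (I v).2) ∧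
    ∀ u ∈ G.verts, ∀ v ∈ G.verts, u ≠ v → ((ivl I u ∩ ivl I v).Nonempty ↔ G.Adj u v)

/-- A proper interval representation: no interval properly contains another. -/
def IsProperRep (G : GraphOn V) (I : V → ℝ × ℝ) : Prop :=
  G.IsRep I ∧ ∀ u ∈ G.verts, ∀ v ∈ G.verts, u ≠ v → ¬ ivl I v ⊂ ivl I u

/-- A unit interval representation: all intervals have length one. -/
def IsUnitRep (G : GraphOn V) (I : V → ℝ × ℝ) : Prop :=
  G.IsRep I ∧ ∀ v ∈ G.verts, (I v).2 = (I v).1 + 1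

/-- Two vertices are in the same block iff they have equal closed neighborhoods. -/
def SameBlock (G : GraphOn V) (u v : V) : Prop :=
  u ∈ G.verts ∧ v ∈ G.verts ∧ ∀ w, (G.Adj u w ∨ u = w) ↔ (G.Adj v w ∨ v = w)

/-- Block-level closed adjacency: adjacent or in the same block. -/
def CAdj (G : GraphOn V) (u v : V) : Prop := G.Adj u v ∨ G.SameBlock u v

/-- `u` and `v` lie in the same connected component of `G` (and in `G`). -/
def Reach (G : GraphOn V) (u v : V) : Prop :=
  u ∈ G.verts ∧ v ∈ G.verts ∧ Relation.ReflTransGen G.Adj u v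

/-- The subgraph of `G` induced on the vertices of `G` lying in `C`. -/
def restrict (G : GraphOn V) (C : Set V) : GraphOn V where
  verts := G.verts ∩ C
  Adj u v := G.Adj u v ∧ u ∈ C ∧ v ∈ C
  symm h := ⟨G.symm h.1, h.2.2, h.2.1⟩
  loopless v h := G.loopless v h.1
  mem_of_adj h := ⟨⟨(G.mem_of_adj h.1).1, h.2.1⟩, (G.mem_of_adj h.1).2, h.2.2⟩

end GraphOn

open GraphOn

variable {V : Type u}

/-- The union graph `G_1 ∪ … ∪ G_k`. -/
def unionGraph {k : ℕ} (G : Fin k → GraphOn V) : GraphOn V where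
  verts := ⋃ i, (G i).verts
  Adj u v := ∃ i, (G i).Adj u v
  symm h := h.elim fun i hi => ⟨i, (G i).symm hi⟩
  loopless v h := h.elim fun i hi => (G i).loopless v hi
  mem_of_adj h := h.elim fun i hi =>
    ⟨Set.mem_iUnion.2 ⟨i, ((G i).mem_of_adj hi).1⟩,
     Set.mem_iUnion.2 ⟨i, ((G i).mem_of_adj hi).2⟩⟩

/-- A straight enumeration of `G`, encoded at the vertex level: `le u v` means the
block of `u` comes at or before the block of `v`.  It is a total preorder on the
vertices whose equivalence classes are exactly the blocks, and such that every block
together with its adjacent blocks is consecutive. -/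
structure StraightEnum {V : Type u} (G : GraphOn V) where
  le : V → V → Prop
  refl : ∀ v ∈ G.verts, le v v
  trans : ∀ u ∈ G.verts, ∀ v ∈ G.verts, ∀ w ∈ G.verts, le u v → le v w → le u w
  total : ∀ u ∈ G.verts, ∀ v ∈ G.verts, le u v ∨ le v u
  eq_block : ∀ u ∈ G.verts, ∀ v ∈ G.verts, (le u v ∧ le v u ↔ G.SameBlock u v)
  straight : ∀ u ∈ G.verts, ∀ v ∈ G.verts, ∀ w ∈ G.verts,
    le u v → le v w → G.CAdj u w → G.CAdj u v ∧ G.CAdj v w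

/-- `B(u,G) <_σ B(v,G)`: the block of `u` comes strictly before the block of `v`. -/
def StraightEnum.lt {V : Type u} {G : GraphOn V} (σ : StraightEnum G) (u v : V) : Prop :=
  σ.le u v ∧ ¬ σ.le v u

/-- `le` is a linear order on the set `s`. -/
def IsLinOrdOn (s : Set V) (le : V → V → Prop) : Prop :=
  (∀ v ∈ s, le v v) ∧ (∀ u ∈ s, ∀ v ∈ s, ∀ w ∈ s, le u v → le v w → le u w) ∧
    (∀ u ∈ s, ∀ v ∈ s, le u v → le v u → u = v) ∧ (∀ u ∈ s, ∀ v ∈ s, le u v ∨ le v u)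

/-- `le` is a partial order on the set `s`. -/
def IsPartialOrderOn (s : Set V) (le : V → V → Prop) : Prop :=
  (∀ v ∈ s, le v v) ∧ (∀ u ∈ s, ∀ v ∈ s, ∀ w ∈ s, le u v → le v w → le u w) ∧
    (∀ u ∈ s, ∀ v ∈ s, le u v → le v u → u = v)

/-- `S` is an induced subgraph of `G`. -/
def IsInduced (S G : GraphOn V) : Prop :=
  S.verts ⊆ G.verts ∧ ∀ u ∈ S.verts, ∀ v ∈ S.verts, (S.Adj u v ↔ G.Adj u v)

/-- `(G_1,…,G_k)` is a sunflower graph with shared graph `S`: any two distinct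
graphs share exactly `S` (vertices and edges), and `S` is induced in each `G_i`. -/
def IsSunflower {k : ℕ} (G : Fin k → GraphOn V) (S : GraphOn V) : Prop :=
  (∀ i, IsInduced S (G i)) ∧
    ∀ i j, i ≠ j → (G i).verts ∩ (G j).verts = S.verts ∧
      ∀ u v, (G i).Adj u v → (G j).Adj u v → S.Adj u v

/-- `𝒢` admits a simultaneous interval representation. -/
def HasSimRep {k : ℕ} (G : Fin k → GraphOn V) : Prop :=
  ∃ I : V → ℝ × ℝ, ∀ i, (G i).IsRep I

/-- `𝒢` admits a simultaneous proper interval representation. -/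
def HasSimProperRep {k : ℕ} (G : Fin k → GraphOn V) : Prop :=
  ∃ I : V → ℝ × ℝ, ∀ i, (G i).IsProperRep I

/-- `𝒢` admits a simultaneous unit interval representation. -/
def HasSimUnitRep {k : ℕ} (G : Fin k → GraphOn V) : Prop :=
  ∃ I : V → ℝ × ℝ, ∀ i, (G i).IsUnitRep I

/-- The representation `I` of `G` corresponds to (realizes) the straight enumeration `σ`:
ordering the intervals by left endpoints and grouping blocks yields `σ`. -/
def Realizes (G : GraphOn V) (I : V → ℝ × ℝ) (σ : StraightEnum G) : Prop :=
  ∀ u ∈ G.verts, ∀ v ∈ G.verts, σ.lt u v → (I u).1 < (I v).1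

/-- Simultaneous enumeration: blocks containing shared vertices are never ordered
oppositely in two of the straight enumerations. -/
def IsSimEnum {k : ℕ} (G : Fin k → GraphOn V) (S : GraphOn V)
    (σ : ∀ i, StraightEnum (G i)) : Prop :=
  ∀ i j, ∀ u ∈ S.verts, ∀ v ∈ S.verts, (σ i).lt u v → (σ j).le u v

/-- A straight enumeration `σ` of `G` is compatible with a linear order `ζ` of the
shared vertex set `VS`: `u ≤_ζ v` implies `B(u,G) ≤_σ B(v,G)`. -/
def Compatible (G : GraphOn V) (σ : StraightEnum G) (VS : Set V) (ζ : V → V → Prop) : Prop :=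
  ∀ u ∈ VS, ∀ v ∈ VS, ζ u v → σ.le u v

/-- The component of `c` in `G` is loose: all its shared vertices lie in one block of `S`. -/
def LooseAt (G S : GraphOn V) (c : V) : Prop :=
  c ∈ G.verts ∧ ∀ u v, G.Reach c u → G.Reach c v → u ∈ S.verts → v ∈ S.verts → S.SameBlock u v

/-- The component of `c` in `G` is oriented at the block of `b` in `S`: it aligns two
vertices of that block (they lie in different blocks of the component). -/
def OrientedAt (G S : GraphOn V) (c b : V) : Prop :=
  c ∈ G.verts ∧ b ∈ S.verts ∧ ∃ u v, G.Reach c u ∧ G.Reach c v ∧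
    S.SameBlock b u ∧ S.SameBlock b v ∧ ¬ G.SameBlock u v

/-- The component of `c` in `G` is independent: it aligns no two shared vertices. -/
def IndependentAt (G S : GraphOn V) (c : V) : Prop :=
  c ∈ G.verts ∧ ∀ u v, G.Reach c u → G.Reach c v → u ∈ S.verts → v ∈ S.verts → G.SameBlock u v

/-- `le'` is obtained from `le` by reversing exactly the components marked by `flip`
(componentwise-constant), keeping the order of the components themselves. -/
def ObtainedByFlip (G : GraphOn V) (flip : V → Prop) (le le' : V → V → Prop) : Prop :=
  (∀ u v, G.Reach u v → (flip u ↔ flip v)) ∧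
    ∀ u ∈ G.verts, ∀ v ∈ G.verts,
      (G.Reach u v → ((flip u → (le' u v ↔ le v u)) ∧ (¬ flip u → (le' u v ↔ le u v)))) ∧
      (¬ G.Reach u v → (le' u v ↔ le u v))

/-- `le'` is obtained from `le` through reversal of loose components. -/
def ObtainedByLooseReversals (G S : GraphOn V) (le le' : V → V → Prop) : Prop :=
  ∃ flip : V → Prop, (∀ c ∈ G.verts, flip c → LooseAt G S c) ∧
    ObtainedByFlip G flip le le'

/-- A family of flips (one per graph) corresponding to reversals of independent
components and of reversible parts: only loose components are flipped, and all
components oriented at a common block of `S` are flipped consistently and, if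
flipped, are all loose. -/
def ValidFlips {k : ℕ} (G : Fin k → GraphOn V) (S : GraphOn V)
    (flip : Fin k → V → Prop) : Prop :=
  (∀ i, ∀ c ∈ (G i).verts, flip i c → LooseAt (G i) S c) ∧
    ∀ b ∈ S.verts, ∀ i j c c', OrientedAt (G i) S c b → OrientedAt (G j) S c' b →
      (flip i c ↔ flip j c') ∧ (flip i c → LooseAt (G j) S c')

/-- `le` is a fine enumeration of the graph with vertex set `verts` and adjacency
`Adj`: a linear order on `verts` in which every closed neighborhood is consecutive. -/
def FineEnumOn (verts : Set V) (Adj : V → V → Prop) (le : V → V → Prop) : Prop :=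
  IsLinOrdOn verts le ∧
    ∀ u ∈ verts, ∀ a ∈ verts, ∀ b ∈ verts, ∀ c ∈ verts,
      le a b → le b c → (Adj u a ∨ u = a) → (Adj u c ∨ u = c) → (Adj u b ∨ u = b)

/-- A `(u,v)`-chain of size `l` in `(G,σ)`: a `σ`-increasing sequence from `u` to `v`
forming a path in `G`. -/
def IsChainSeq (G : GraphOn V) (σ : StraightEnum G) (u v : V) (l : ℕ) : Prop :=
  ∃ c : ℕ → V, c 0 = u ∧ c (l - 1) = v ∧ (∀ t < l, c t ∈ G.verts) ∧
    (∀ s t, s < t → t < l → σ.lt (c s) (c t)) ∧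
    (∀ t, t + 1 < l → G.Adj (c t) (c (t + 1)))

/-- A `(u,v)`-bar of size `l` in `(G,σ)`: a `σ`-increasing sequence from `u` to `v`
forming an independent set in `G`. -/
def IsBarSeq (G : GraphOn V) (σ : StraightEnum G) (u v : V) (l : ℕ) : Prop :=
  ∃ b : ℕ → V, b 0 = u ∧ b (l - 1) = v ∧ (∀ t < l, b t ∈ G.verts) ∧
    (∀ s t, s < t → t < l → σ.lt (b s) (b t)) ∧
    (∀ s t, s < l → t < l → s ≠ t → ¬ G.Adj (b s) (b t))

/-- `𝒢` has a (chain-bar-)conflict for the simultaneous enumeration `σ`. -/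
def HasConflict {k : ℕ} (G : Fin k → GraphOn V) (S : GraphOn V)
    (σ : ∀ i, StraightEnum (G i)) : Prop :=
  ∃ u ∈ S.verts, ∃ v ∈ S.verts, u ≠ v ∧ ∃ i j l, 2 ≤ l ∧
    IsChainSeq (G i) (σ i) u v l ∧ ∃ m, l ≤ m ∧ IsBarSeq (G j) (σ j) u v m

/-- The union of the block orders of the single enumerations. -/
def alphaStar {k : ℕ} (G : Fin k → GraphOn V) (σ : ∀ i, StraightEnum (G i))
    (u v : V) : Prop :=
  ∃ i, u ∈ (G i).verts ∧ v ∈ (G i).verts ∧ (σ i).le u v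

/-- The partial order `α` on `V(𝒢)` induced by the simultaneous enumeration:
the transitive closure of the union of the single block orders. -/
def alphaOrd {k : ℕ} (G : Fin k → GraphOn V) (σ : ∀ i, StraightEnum (G i)) :
    V → V → Prop :=
  Relation.TransGen (alphaStar G σ)

/-- The `α`-ordered pairs that are edges of some `G_i`. -/
def ERel {k : ℕ} (G : Fin k → GraphOn V) (σ : ∀ i, StraightEnum (G i))
    (u v : V) : Prop :=
  alphaOrd G σ u v ∧ ∃ i, (G i).Adj u v

/-- The `α`-ordered pairs that are non-edges of some `G_i` (both endpoints in `G_i`). -/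
def FRel {k : ℕ} (G : Fin k → GraphOn V) (σ : ∀ i, StraightEnum (G i))
    (u v : V) : Prop :=
  alphaOrd G σ u v ∧ u ≠ v ∧ ∃ i, u ∈ (G i).verts ∧ v ∈ (G i).verts ∧ ¬ (G i).Adj u v

/-- A partial order `τ` is left-closed: `(v,w) ∈ E`, `(u,x) ∈ F` and `x ≤_τ w`
imply `u <_τ v`. -/
def LeftClosed {k : ℕ} (G : Fin k → GraphOn V) (σ : ∀ i, StraightEnum (G i))
    (τ : V → V → Prop) : Prop :=
  ∀ v w u x, ERel G σ v w → FRel G σ u x → τ x w → τ u v ∧ u ≠ v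

/-- A relaxed `(u,v)`-chain of size `l`: an `α`-increasing sequence from `u` to `v`
forming a path in the union graph `G* = G_1 ∪ … ∪ G_k`. -/
def IsRelaxedChainSeq {k : ℕ} (G : Fin k → GraphOn V) (σ : ∀ i, StraightEnum (G i))
    (u v : V) (l : ℕ) : Prop :=
  ∃ c : ℕ → V, c 0 = u ∧ c (l - 1) = v ∧ (∀ t < l, c t ∈ ⋃ i, (G i).verts) ∧
    (∀ s t, s < t → t < l → alphaOrd G σ (c s) (c t) ∧ c s ≠ c t) ∧
    (∀ t, t + 1 < l → ∃ i, (G i).Adj (c t) (c (t + 1)))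

/-- `𝒢` has a relaxed conflict for the simultaneous enumeration `σ`. -/
def HasRelaxedConflict {k : ℕ} (G : Fin k → GraphOn V) (S : GraphOn V)
    (σ : ∀ i, StraightEnum (G i)) : Prop :=
  ∃ u ∈ S.verts, ∃ v ∈ S.verts, u ≠ v ∧ ∃ j l, 2 ≤ l ∧
    IsRelaxedChainSeq G σ u v l ∧ ∃ m, l ≤ m ∧ IsBarSeq (G j) (σ j) u v m

namespace GraphOn

variable {G S : GraphOn V} {u v w : V}

theorem SameBlock.symm (h : G.SameBlock u v) : G.SameBlock v u :=
  ⟨h.2.1, h.1, fun w => (h.2.2 w).symm⟩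

theorem SameBlock.trans (h : G.SameBlock u v) (h' : G.SameBlock v w) : G.SameBlock u w :=
  ⟨h.1, h'.2.1, fun x => (h.2.2 x).trans (h'.2.2 x)⟩

theorem SameBlock.refl (h : v ∈ G.verts) : G.SameBlock v v :=
  ⟨h, h, fun _ => Iff.rfl⟩

theorem SameBlock.adj_or_eq (h : G.SameBlock u v) : G.Adj u v ∨ u = v :=
  (h.2.2 v).2 (Or.inr rfl)

theorem cAdj_iff (hv : v ∈ G.verts) : G.CAdj u v ↔ G.Adj u v ∨ u = v := by
  constructor
  · rintro (h | h)
    · exact Or.inl h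
    · exact h.adj_or_eq
  · rintro (h | rfl)
    · exact Or.inl h
    · exact Or.inr (SameBlock.refl hv)

theorem CAdj.symm (h : G.CAdj u v) : G.CAdj v u :=
  h.imp (fun h => G.symm h) SameBlock.symm

theorem Reach.refl (h : v ∈ G.verts) : G.Reach v v := ⟨h, h, .refl⟩

theorem Reach.symm (h : G.Reach u v) : G.Reach v u :=
  ⟨h.2.1, h.1, by
    have : Std.Symm G.Adj := ⟨fun _ _ h => G.symm h⟩
    exact Relation.ReflTransGen.stdSymm.symm _ _ h.2.2⟩

theorem Reach.trans (h : G.Reach u v) (h' : G.Reach v w) : G.Reach u w :=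
  ⟨h.1, h'.2.1, h.2.2.trans h'.2.2⟩

theorem Reach.of_adj (h : G.Adj u v) : G.Reach u v :=
  ⟨(G.mem_of_adj h).1, (G.mem_of_adj h).2, .single h⟩

theorem SameBlock.reach (h : G.SameBlock u v) : G.Reach u v := by
  obtain h' | rfl := h.adj_or_eq
  · exact .of_adj h'
  · exact .refl h.1

/-- Shared vertices in the same block of the big graph are in the same block of an
induced subgraph. -/
theorem SameBlock.of_isInduced (hS : IsInduced S G) (hu : u ∈ S.verts) (hv : v ∈ S.verts)
    (h : G.SameBlock u v) : S.SameBlock u v := by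
  refine ⟨hu, hv, fun w => ?_⟩
  by_cases hw : w ∈ S.verts
  · rw [hS.2 u hu w hw, hS.2 v hv w hw]
    exact h.2.2 w
  · have h1 : ∀ x ∈ S.verts, ¬ (S.Adj x w ∨ x = w) := by
      rintro x hx (hxw | rfl)
      · exact hw (S.mem_of_adj hxw).2
      · exact hw hx
    exact iff_of_false (h1 u hu) (h1 v hv)

/-- Vertices in the same block of an induced subgraph are connected in the big graph. -/
theorem SameBlock.reach_of_isInduced (hS : IsInduced S G) (h : S.SameBlock u v) :
    G.Reach u v := by
  obtain h' | rfl := h.adj_or_eq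
  · exact .of_adj ((hS.2 u h.1 v h.2.1).1 h')
  · exact .refl (hS.1 h.1)

end GraphOn

/-- A symmetric block-invariant property `A` of pairs of inequivalent elements is constant,
provided it is constant on `R`-triangles, `R` is connected, and `R x v` transports `A` from
`(u, x)` to `(u, v)` whenever `u` is not related to `v`. -/
theorem forall_or_forall_not_of_connected {M : V → Prop} {R E A : V → V → Prop}
    (mem_of_rel : ∀ {a b}, R a b → M a ∧ M b) (rel_symm : ∀ {a b}, R a b → R b a)
    (conn : ∀ u v, M u → M v → Relation.ReflTransGen R u v)
    (equiv_refl : ∀ {a}, M a → E a a) (equiv_symm : ∀ {a b}, E a b → E b a)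
    (equiv_trans : ∀ {a b c}, E a b → E b c → E a c)
    (agree_symm : ∀ {a b}, M a → M b → ¬ E a b → (A a b ↔ A b a))
    (agree_congr : ∀ {a b c}, M a → M b → M c → E a b → ¬ E a c → (A a c ↔ A b c))
    (rel_congr : ∀ {a b c}, M a → E a b → R b c → ¬ E a c → R a c)
    (triangle : ∀ {a b c}, R a b → R b c → R a c → ¬ E a b → ¬ E b c → ¬ E a c →
      (A a b ↔ A b c))
    (transport : ∀ {u x v}, M u → R x v → ¬ R u v → ¬ E x v → ¬ E u x → ¬ E u v →
      (A u x ↔ A u v)) :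
    (∀ u v, M u → M v → ¬ E u v → A u v) ∨ (∀ u v, M u → M v → ¬ E u v → ¬ A u v) := by
  have path : ∀ {a b c}, R a b → R b c → ¬ E a b → ¬ E b c → (A a b ↔ A b c) := by
    intro a b c hab hbc nab nbc
    have ha := (mem_of_rel hab).1
    have hb := (mem_of_rel hab).2
    have hc := (mem_of_rel hbc).2
    by_cases eac : E a c
    · exact (agree_congr ha hc hb eac nab).trans
        (agree_symm hc hb fun h => nbc (equiv_symm h))
    by_cases hac : R a c
    · exact triangle hab hbc hac nab nbc eac
    · have h1 : A a b ↔ A a c := transport ha hbc hac nbc nab eac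
      have h2 : A c b ↔ A c a := transport hc (rel_symm hab) (fun h => hac (rel_symm h))
        (fun h => nab (equiv_symm h)) (fun h => nbc (equiv_symm h)) (fun h => eac (equiv_symm h))
      rw [h1, agree_symm hb hc nbc, h2, agree_symm ha hc eac]
  by_cases hM : ∃ u₀, M u₀
  swap
  · exact Or.inl fun u _ hu => absurd ⟨u, hu⟩ hM
  obtain ⟨u₀, hu₀⟩ := hM
  obtain ⟨p, hp⟩ : ∃ p : Prop, ∀ v, R u₀ v → ¬ E u₀ v → (A u₀ v ↔ p) := by
    refine ⟨∃ w, R u₀ w ∧ ¬ E u₀ w ∧ A u₀ w, fun v hv nv => ⟨fun h => ⟨v, hv, nv, h⟩, ?_⟩⟩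
    rintro ⟨w, hw, nw, h⟩
    have hm := mem_of_rel hw
    rw [agree_symm hm.1 hm.2 nw] at h
    exact (path (rel_symm hw) hv (fun h => nw (equiv_symm h)) nv).1 h
  have all_rel : ∀ u, M u → ∀ v, R u v → ¬ E u v → (A u v ↔ p) := by
    intro u hu
    have hc := conn u₀ u hu₀ hu
    clear hu
    induction hc with
    | refl => exact hp
    | @tail x y _ hxy ih =>
      intro v hv nv
      have hm := mem_of_rel hxy
      by_cases exy : E x y
      · have nxv : ¬ E x v := fun h => nv (equiv_trans (equiv_symm exy) h)
        rw [← agree_congr hm.1 hm.2 (mem_of_rel hv).2 exy nxv]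
        exact ih v (rel_congr hm.1 exy hv nxv) nxv
      · rw [← path hxy hv exy nv]
        exact ih y hxy exy
  have all : ∀ u v, M u → M v → ¬ E u v → (A u v ↔ p) := by
    intro u v hu hv
    have hc := conn u v hu hv
    clear hv
    induction hc with
    | refl =>
      exact fun n => absurd (equiv_refl hu) n
    | @tail x y _ hxy ih =>
      intro n
      have hm := mem_of_rel hxy
      by_cases exy : E x y
      · have nux : ¬ E u x := fun h => n (equiv_trans h exy)
        rw [agree_symm hu hm.2 n, ← agree_congr hm.1 hm.2 hu exy fun h => nux (equiv_symm h),
          ← agree_symm hu hm.1 nux]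
        exact ih nux
      · by_cases eux : E u x
        · rw [agree_congr hu hm.1 hm.2 eux n]
          exact all_rel x hm.1 y hxy exy
        · by_cases huy : R u y
          · exact all_rel u hu y huy n
          · rw [← transport hu hxy huy exy eux n]
            exact ih eux
  by_cases h : p
  · exact Or.inl fun u v hu hv n => (all u v hu hv n).2 h
  · exact Or.inr fun u v hu hv n hA => h ((all u v hu hv n).1 hA)

namespace StraightEnum

variable {G : GraphOn V} {u v w x y : V}

/-- The reversal of a straight enumeration. -/
def reverse (σ : StraightEnum G) : StraightEnum G where
  le a b := σ.le b a
  refl := σ.refl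
  trans u hu v hv w hw huv hvw := σ.trans w hw v hv u hu hvw huv
  total u hu v hv := σ.total v hv u hu
  eq_block u hu v hv := by rw [and_comm]; exact σ.eq_block u hu v hv
  straight u hu v hv w hw huv hvw h :=
    have h' := σ.straight w hw v hv u hu hvw huv h.symm
    ⟨h'.2.symm, h'.1.symm⟩

variable (σ σ' : StraightEnum G)

theorem le_of_not_le (hu : u ∈ G.verts) (hv : v ∈ G.verts) (h : ¬ σ.le u v) : σ.le v u :=
  (σ.total u hu v hv).resolve_left h

theorem le_iff_not_le (hu : u ∈ G.verts) (hv : v ∈ G.verts) (h : ¬ G.SameBlock u v) :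
    σ.le u v ↔ ¬ σ.le v u := by
  have h1 := σ.total u hu v hv
  have h2 := σ.eq_block u hu v hv
  tauto

theorem le_congr_left (hv : v ∈ G.verts) (h : G.SameBlock u w) : σ.le u v ↔ σ.le w v := by
  have h1 := (σ.eq_block u h.1 w h.2.1).2 h
  exact ⟨fun h2 => σ.trans w h.2.1 u h.1 v hv h1.2 h2,
    fun h2 => σ.trans u h.1 w h.2.1 v hv h1.1 h2⟩

/-- A vertex not adjacent to `v` does not lie between `v` and a neighbor of `v`. -/
theorem le_iff_le_of_adj (hu : u ∈ G.verts) (h : G.Adj x v) (n : ¬ G.CAdj u v) :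
    σ.le u x ↔ σ.le u v := by
  obtain ⟨hx, hv⟩ := G.mem_of_adj h
  constructor
  · intro h1
    by_contra h2
    exact n (σ.straight v hv u hu x hx (σ.le_of_not_le hu hv h2) h1 (Or.inl (G.symm h))).1.symm
  · intro h1
    by_contra h2
    exact n (σ.straight x hx u hu v hv (σ.le_of_not_le hu hx h2) h1 (Or.inl h)).2

/-- A component lies entirely on one side of any vertex outside of it. -/
theorem le_iff_le_of_reach (hu : u ∈ G.verts) (h : G.Reach x v) (n : ¬ G.Reach u v) :
    σ.le u x ↔ σ.le u v := by
  obtain ⟨_, hv, h⟩ := h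
  clear hv
  induction h with
  | refl => exact Iff.rfl
  | @tail y z _ hyz ih =>
    have hr := Reach.of_adj hyz
    rw [ih fun h => n (h.trans hr)]
    refine σ.le_iff_le_of_adj hu hyz fun h => n ?_
    obtain h | h := h
    · exact .of_adj h
    · exact h.reach

theorem le_iff_le_of_reach_of_reach (hu : G.Reach u w) (hv : G.Reach v x)
    (n : ¬ G.Reach u v) : σ.le u v ↔ σ.le w x := by
  rw [σ.le_iff_le_of_reach hu.1 hv fun h => n (h.trans hv.symm)]
  exact σ.reverse.le_iff_le_of_reach hv.2.1 hu fun h => n (hu.trans (h.symm.trans hv.symm))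

/-- Any two straight enumerations agree up to reversal on each connected component. -/
theorem forall_reach_le_iff_or_not (c : V) :
    (∀ u v, G.Reach c u → G.Reach c v → ¬ G.SameBlock u v → (σ.le u v ↔ σ'.le u v)) ∨
    (∀ u v, G.Reach c u → G.Reach c v → ¬ G.SameBlock u v → ¬ (σ.le u v ↔ σ'.le u v)) := by
  have agree_symm : ∀ {a b}, a ∈ G.verts → b ∈ G.verts → ¬ G.SameBlock a b →
      ((σ.le a b ↔ σ'.le a b) ↔ (σ.le b a ↔ σ'.le b a)) := by
    intro a b ha hb n
    rw [σ.le_iff_not_le ha hb n, σ'.le_iff_not_le ha hb n, not_iff_not]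
  have transport : ∀ {u x v}, u ∈ G.verts → G.Adj x v → ¬ G.Adj u v → ¬ G.SameBlock u v →
      ((σ.le u x ↔ σ'.le u x) ↔ (σ.le u v ↔ σ'.le u v)) := by
    intro u x v hu hxv n n'
    have hn : ¬ G.CAdj u v := fun h => h.elim n n'
    rw [σ.le_iff_le_of_adj hu hxv hn, σ'.le_iff_le_of_adj hu hxv hn]
  -- a vertex adjacent to `a` but not to `b`
  have step : ∀ {a b c w}, G.Adj a b → G.Adj b c → G.Adj a c → G.Adj a w →
      ¬ G.Adj b w → b ≠ w → ¬ G.SameBlock a b → ¬ G.SameBlock b c → ¬ G.SameBlock a c →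
      ((σ.le a b ↔ σ'.le a b) ↔ (σ.le a c ↔ σ'.le a c)) ∨
      ((σ.le a b ↔ σ'.le a b) ↔ (σ.le b c ↔ σ'.le b c)) := by
    intro a b c w hab hbc hac haw nbw nebw nab nbc nac
    obtain ⟨ha, hb⟩ := G.mem_of_adj hab
    obtain ⟨_, hc⟩ := G.mem_of_adj hbc
    obtain ⟨_, hw⟩ := G.mem_of_adj haw
    have nsb : ¬ G.SameBlock b w := fun h => h.adj_or_eq.elim nbw nebw
    have bw := transport hb haw nbw nsb
    by_cases hcw : G.Adj c w
    · right
      rw [agree_symm ha hb nab, bw, ← transport hb hcw nbw nsb]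
    · left
      have ncw : c ≠ w := by
        rintro rfl
        exact nbw hbc
      have nscw : ¬ G.SameBlock c w := fun h => h.adj_or_eq.elim hcw ncw
      have nwb : ¬ G.Adj w b := fun h => nbw (G.symm h)
      have nwc : ¬ G.Adj w c := fun h => hcw (G.symm h)
      have h1 := transport hw hab nwb fun h => nsb h.symm
      have h2 := transport hw hac nwc fun h => nscw h.symm
      have h3 := transport hc haw hcw nscw
      rw [agree_symm ha hb nab, bw, agree_symm hb hw nsb, ← h1, h2,
        ← agree_symm hc hw nscw, ← h3, agree_symm ha hc nac]
  -- each edge of a triangle agrees with one of the other two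
  have odd : ∀ {a b c}, G.Adj a b → G.Adj b c → G.Adj a c →
      ¬ G.SameBlock a b → ¬ G.SameBlock b c → ¬ G.SameBlock a c →
      ((σ.le a b ↔ σ'.le a b) ↔ (σ.le a c ↔ σ'.le a c)) ∨
      ((σ.le a b ↔ σ'.le a b) ↔ (σ.le b c ↔ σ'.le b c)) := by
    intro a b c hab hbc hac nab nbc nac
    obtain ⟨ha, hb⟩ := G.mem_of_adj hab
    have hex : ∃ w, ¬ ((G.Adj a w ∨ a = w) ↔ (G.Adj b w ∨ b = w)) := by
      by_contra! h
      exact nab ⟨ha, hb, h⟩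
    obtain ⟨w, hw⟩ := hex
    have hba := G.symm hab
    by_cases h1 : G.Adj a w ∨ a = w
    · have h2 : ¬ (G.Adj b w ∨ b = w) := fun h => hw (iff_of_true h1 h)
      rw [not_or] at h2
      obtain h1 | rfl := h1
      · exact step hab hbc hac h1 h2.1 h2.2 nab nbc nac
      · exact absurd hba h2.1
    · have h2 : G.Adj b w ∨ b = w := by
        by_contra h
        exact hw (iff_of_false h1 h)
      rw [not_or] at h1
      obtain h2 | rfl := h2
      · rw [agree_symm ha hb nab]
        exact (step hba hac hbc h2 h1.1 h1.2 (fun h => nab h.symm) nac nbc).symm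
      · exact absurd hab h1.1
  refine forall_or_forall_not_of_connected (M := G.Reach c)
    (R := fun a b => G.Reach c a ∧ G.Adj a b) (E := G.SameBlock)
    (A := fun a b => (σ.le a b ↔ σ'.le a b))
    ?_ ?_ ?_ ?_ ?_ ?_ ?_ ?_ ?_ ?_ ?_
  · exact fun h => ⟨h.1, h.1.trans (.of_adj h.2)⟩
  · exact fun h => ⟨h.1.trans (.of_adj h.2), G.symm h.2⟩
  · intro u v hu hv
    have h := (hu.symm.trans hv).2.2
    clear hv
    induction h with
    | refl => exact .refl
    | @tail x y hx hxy ih =>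
      exact ih.tail ⟨hu.trans ⟨hu.2.1, (G.mem_of_adj hxy).1, hx⟩, hxy⟩
  · exact fun h => .refl h.2.1
  · exact fun h => h.symm
  · exact fun h h' => h.trans h'
  · exact fun ha hb n => agree_symm ha.2.1 hb.2.1 n
  · intro a b c _ _ hc h _
    rw [σ.le_congr_left hc.2.1 h, σ'.le_congr_left hc.2.1 h]
  · intro a b c ha hab hbc n
    obtain h | rfl := (hab.2.2 c).2 (Or.inl hbc.2)
    · exact ⟨ha, h⟩
    · exact absurd (.refl ha.2.1) n
  · intro a b c hab hbc hac nab nbc nac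
    have hab := hab.2
    have hbc := hbc.2
    have hac := hac.2
    obtain ⟨ha, hb⟩ := G.mem_of_adj hab
    obtain ⟨_, hc⟩ := G.mem_of_adj hbc
    have h1 := odd hab hbc hac nab nbc nac
    have h2 := odd hbc (G.symm hac) (G.symm hab) nbc (fun h => nac h.symm) fun h => nab h.symm
    have h3 := odd hac (G.symm hbc) hab nac (fun h => nbc h.symm) nab
    rw [← agree_symm ha hb nab, ← agree_symm ha hc nac] at h2
    rw [← agree_symm hb hc nbc] at h3
    by_cases p : (σ.le a b ↔ σ'.le a b) <;> by_cases q : (σ.le b c ↔ σ'.le b c) <;>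
      by_cases r : (σ.le a c ↔ σ'.le a c) <;>
      simp only [p, q, r] at h1 h2 h3 ⊢ <;> simp at h1 h2 h3
  · intro u x v hu hxv n _ _ nuv
    exact transport hu.2.1 hxv.2 (fun h => n ⟨hu, h⟩) nuv

/-- Blocks of an induced subgraph are convex among its vertices. -/
theorem sameBlock_of_le_of_le {S : GraphOn V} (hS : IsInduced S G) (hv : v ∈ S.verts)
    (h : S.SameBlock u w) (huv : σ.le u v) (hvw : σ.le v w) : S.SameBlock u v := by
  obtain ⟨hu, hw, hb⟩ := h
  have huG := hS.1 hu
  have hvG := hS.1 hv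
  have hwG := hS.1 hw
  have cAdj : ∀ {a b}, a ∈ S.verts → b ∈ S.verts → (G.CAdj a b ↔ (S.Adj a b ∨ a = b)) := by
    intro a b ha hb
    rw [cAdj_iff (hS.1 hb), hS.2 a ha b hb]
  have huw : G.CAdj u w := (cAdj hu hw).2 ((hb w).2 (Or.inr rfl))
  refine ⟨hu, hv, fun x => ?_⟩
  by_cases hx : x ∈ S.verts
  swap
  · have h1 : ∀ y ∈ S.verts, ¬ (S.Adj y x ∨ y = x) := by
      rintro y hy (hyx | rfl)
      · exact hx (S.mem_of_adj hyx).2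
      · exact hx hy
    exact iff_of_false (h1 u hu) (h1 v hv)
  have hxG := hS.1 hx
  have hb' : G.CAdj u x ↔ G.CAdj w x := by
    rw [cAdj hu hx, cAdj hw hx]
    exact hb x
  rw [← cAdj hu hx, ← cAdj hv hx]
  constructor
  · intro h
    obtain h1 | h1 := σ.total x hxG v hvG
    · exact (σ.straight x hxG v hvG w hwG h1 hvw (hb'.1 h).symm).1.symm
    · exact (σ.straight u huG v hvG x hxG huv h1 h).2
  · intro h
    obtain h1 | h1 := σ.total x hxG u huG
    · exact (σ.straight x hxG u huG v hvG h1 huv h.symm).1.symm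
    · obtain h2 | h2 := σ.total x hxG w hwG
      · exact (σ.straight u huG x hxG w hwG h1 h2 huw).1
      · exact hb'.2 (σ.straight v hvG w hwG x hxG hvw h2 h).2

/-- The order relative to a shared vertex only depends on the shared block. -/
theorem le_congr_of_sameBlock {S : GraphOn V} (hS : IsInduced S G) (hv : v ∈ S.verts)
    (h : S.SameBlock u w) (n : ¬ S.SameBlock u v) : σ.le u v ↔ σ.le w v := by
  have huG := hS.1 h.1
  have hvG := hS.1 hv
  have hwG := hS.1 h.2.1
  constructor
  · intro h1
    by_contra h2
    exact n (σ.sameBlock_of_le_of_le hS hv h h1 (σ.le_of_not_le hwG hvG h2))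
  · intro h1
    by_contra h2
    exact n (h.trans (σ.sameBlock_of_le_of_le hS hv h.symm h1 (σ.le_of_not_le huG hvG h2)))

end StraightEnum

section Sunflower

variable {k : ℕ} {G : Fin k → GraphOn V} {S : GraphOn V}

/-- `u` and `v` are shared vertices in a common component of one of the graphs. -/
def SharedReach (G : Fin k → GraphOn V) (S : GraphOn V) (u v : V) : Prop :=
  u ∈ S.verts ∧ v ∈ S.verts ∧ ∃ j, (G j).Reach u v

theorem IsSunflower.mem_of_ne (hsun : IsSunflower G S) {i j : Fin k} (h : i ≠ j) {v : V}
    (hi : v ∈ (G i).verts) (hj : v ∈ (G j).verts) : v ∈ S.verts :=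
  (hsun.2 i j h).1 ▸ ⟨hi, hj⟩

theorem IsSunflower.sharedReach_of_connected (hsun : IsSunflower G S) (i : Fin k) {u v : V}
    (hu : u ∈ S.verts) (hv : v ∈ S.verts)
    (h : Relation.ReflTransGen (unionGraph G).Adj u v) :
    Relation.ReflTransGen (SharedReach G S) u v := by
  have key : ∃ t ∈ S.verts, Relation.ReflTransGen (SharedReach G S) u t ∧
      ∃ j, (G j).Reach t v := by
    clear hv
    induction h with
    | refl => exact ⟨u, hu, .refl, i, .refl ((hsun.1 i).1 hu)⟩
    | @tail x y _ hxy ih =>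
      obtain ⟨t, ht, hut, j, htx⟩ := ih
      obtain ⟨m, hm⟩ := hxy
      by_cases hjm : j = m
      · subst hjm
        exact ⟨t, ht, hut, j, htx.trans (.of_adj hm)⟩
      · have hx := hsun.mem_of_ne hjm htx.2.1 ((G m).mem_of_adj hm).1
        exact ⟨x, hx, hut.tail ⟨ht, hx, j, htx⟩, m, .of_adj hm⟩
  obtain ⟨t, ht, hut, htv⟩ := key
  exact hut.tail ⟨ht, hv, htv⟩

theorem IsSunflower.exists_shared_of_not_reach (hsun : IsSunflower G S) {i : Fin k} {u v : V}
    (hu : u ∈ (G i).verts) (n : ¬ (G i).Reach u v)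
    (h : Relation.ReflTransGen (unionGraph G).Adj u v) :
    ∃ s ∈ S.verts, (G i).Reach u s := by
  by_contra! hs
  refine n ?_
  clear n
  induction h with
  | refl => exact .refl hu
  | @tail x y _ hxy ih =>
    obtain ⟨m, hm⟩ := hxy
    by_cases him : i = m
    · subst him
      exact ih.trans (.of_adj hm)
    · exact absurd ih (hs x (hsun.mem_of_ne him ih.2.1 ((G m).mem_of_adj hm).1))

/-- All enumerations of a simultaneous enumeration order shared vertices of different
shared blocks in the same way. -/
theorem IsSimEnum.le_iff_le (hsun : IsSunflower G S) {σ : ∀ i, StraightEnum (G i)}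
    (hσ : IsSimEnum G S σ) (i j : Fin k) {u v : V} (hu : u ∈ S.verts) (hv : v ∈ S.verts)
    (n : ¬ S.SameBlock u v) : (σ i).le u v ↔ (σ j).le u v := by
  have key : ∀ i j, (σ i).le u v → (σ j).le u v := fun i j h =>
    hσ i j u hu v hv ⟨h, ((σ i).le_iff_not_le ((hsun.1 i).1 hu) ((hsun.1 i).1 hv)
      fun h' => n (h'.of_isInduced (hsun.1 i) hu hv)).1 h⟩
  exact ⟨key i j, key j i⟩

/-- Two simultaneous enumerations agree up to reversal on the order of the shared blocks. -/
theorem IsSimEnum.forall_le_iff_or_not (hsun : IsSunflower G S)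
    (hconn : ∀ u ∈ (unionGraph G).verts, ∀ v ∈ (unionGraph G).verts,
      Relation.ReflTransGen (unionGraph G).Adj u v)
    {σ σ' : ∀ i, StraightEnum (G i)} (hσ : IsSimEnum G S σ) (hσ' : IsSimEnum G S σ')
    (i : Fin k) :
    (∀ u v, u ∈ S.verts → v ∈ S.verts → ¬ S.SameBlock u v →
      ((σ i).le u v ↔ (σ' i).le u v)) ∨
    (∀ u v, u ∈ S.verts → v ∈ S.verts → ¬ S.SameBlock u v →
      ¬ ((σ i).le u v ↔ (σ' i).le u v)) := by
  have change : ∀ j {a b}, a ∈ S.verts → b ∈ S.verts → ¬ S.SameBlock a b →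
      (((σ i).le a b ↔ (σ' i).le a b) ↔ ((σ j).le a b ↔ (σ' j).le a b)) := by
    intro j a b ha hb n
    rw [hσ.le_iff_le hsun i j ha hb n, hσ'.le_iff_le hsun i j ha hb n]
  have agree_symm : ∀ {a b}, a ∈ S.verts → b ∈ S.verts → ¬ S.SameBlock a b →
      (((σ i).le a b ↔ (σ' i).le a b) ↔ ((σ i).le b a ↔ (σ' i).le b a)) := by
    intro a b ha hb n
    have hi := hsun.1 i
    have n' : ¬ (G i).SameBlock a b := fun h => n (h.of_isInduced hi ha hb)
    rw [(σ i).le_iff_not_le (hi.1 ha) (hi.1 hb) n', (σ' i).le_iff_not_le (hi.1 ha) (hi.1 hb) n',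
      not_iff_not]
  have transport : ∀ j {u x v}, u ∈ S.verts → x ∈ S.verts → v ∈ S.verts → (G j).Reach x v →
      ¬ (G j).Reach u v → ¬ S.SameBlock u x → ¬ S.SameBlock u v →
      (((σ i).le u x ↔ (σ' i).le u x) ↔ ((σ i).le u v ↔ (σ' i).le u v)) := by
    intro j u x v hu hx hv hxv n nux nuv
    rw [change j hu hx nux, change j hu hv nuv,
      (σ j).le_iff_le_of_reach ((hsun.1 j).1 hu) hxv n,
      (σ' j).le_iff_le_of_reach ((hsun.1 j).1 hu) hxv n]
  have component : ∀ j {a b c}, a ∈ S.verts → b ∈ S.verts → c ∈ S.verts → (G j).Reach a b →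
      (G j).Reach b c → ¬ S.SameBlock a b → ¬ S.SameBlock b c →
      (((σ i).le a b ↔ (σ' i).le a b) ↔ ((σ i).le b c ↔ (σ' i).le b c)) := by
    intro j a b c ha hb hc hab hbc nab nbc
    have nab' : ¬ (G j).SameBlock a b := fun h => nab (h.of_isInduced (hsun.1 j) ha hb)
    have nbc' : ¬ (G j).SameBlock b c := fun h => nbc (h.of_isInduced (hsun.1 j) hb hc)
    rw [change j ha hb nab, change j hb hc nbc]
    have hbb := hab.symm.trans hab
    obtain h | h := (σ j).forall_reach_le_iff_or_not (σ' j) b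
    · exact iff_of_true (h a b hab.symm hbb nab') (h b c hbb hbc nbc')
    · exact iff_of_false (h a b hab.symm hbb nab') (h b c hbb hbc nbc')
  refine forall_or_forall_not_of_connected (M := fun v => v ∈ S.verts)
    (R := SharedReach G S) (E := S.SameBlock)
    (A := fun a b => ((σ i).le a b ↔ (σ' i).le a b))
    ?_ ?_ ?_ ?_ ?_ ?_ ?_ ?_ ?_ ?_ ?_
  · exact fun h => ⟨h.1, h.2.1⟩
  · exact fun ⟨ha, hb, j, h⟩ => ⟨hb, ha, j, h.symm⟩
  · intro u v hu hv
    have mem : ∀ {x}, x ∈ S.verts → x ∈ (unionGraph G).verts := fun hx =>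
      Set.mem_iUnion.2 ⟨i, (hsun.1 i).1 hx⟩
    exact hsun.sharedReach_of_connected i hu hv (hconn u (mem hu) v (mem hv))
  · exact fun h => .refl h
  · exact fun h => h.symm
  · exact fun h h' => h.trans h'
  · exact agree_symm
  · intro a b c _ _ hc h n
    rw [(σ i).le_congr_of_sameBlock (hsun.1 i) hc h n,
      (σ' i).le_congr_of_sameBlock (hsun.1 i) hc h n]
  · rintro a b c ha hab ⟨_, hc, j, hbc⟩ _
    exact ⟨ha, hc, j, (hab.reach_of_isInduced (hsun.1 j)).trans hbc⟩
  · rintro a b c ⟨ha, hb, j, hab⟩ ⟨_, hc, m, hbc⟩ - nab nbc nac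
    by_cases hj : (G j).Reach b c
    · exact component j ha hb hc hab hj nab nbc
    by_cases hm : (G m).Reach a b
    · exact component m ha hb hc hm hbc nab nbc
    have nba : ¬ S.SameBlock b a := fun h => nab h.symm
    have nca : ¬ S.SameBlock c a := fun h => nac h.symm
    have ncb : ¬ S.SameBlock c b := fun h => nbc h.symm
    have h1 := transport m ha hc hb hbc.symm hm nac nab
    have h2 := transport j hc ha hb hab (fun h => hj h.symm) nca ncb
    rw [← h1, agree_symm ha hc nac, h2, agree_symm hc hb ncb]
  · rintro u x v hu ⟨hx, hv, j, hxv⟩ n - nux nuv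
    exact transport j hu hx hv hxv (fun h => n ⟨hu, hv, j, h⟩) nux nuv

/-- If two straight enumerations order the shared blocks in the same way, they differ by
reversals of loose components. -/
theorem IsSunflower.obtainedByLooseReversals (hsun : IsSunflower G S)
    (hconn : ∀ u ∈ (unionGraph G).verts, ∀ v ∈ (unionGraph G).verts,
      Relation.ReflTransGen (unionGraph G).Adj u v)
    {i : Fin k} (σ σ' : StraightEnum (G i))
    (h : ∀ u v, u ∈ S.verts → v ∈ S.verts → ¬ S.SameBlock u v → (σ.le u v ↔ σ'.le u v)) :
    ObtainedByLooseReversals (G i) S σ.le σ'.le := by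
  have reversed : ∀ c, ¬ (∀ u v, (G i).Reach c u → (G i).Reach c v →
      (σ'.le u v ↔ σ.le u v)) → ∀ u v, (G i).Reach c u → (G i).Reach c v →
      ¬ (G i).SameBlock u v → ¬ (σ.le u v ↔ σ'.le u v) := by
    intro c hc
    refine (σ.forall_reach_le_iff_or_not σ' c).resolve_left fun h' => hc fun u v hu hv => ?_
    by_cases hb : (G i).SameBlock u v
    · exact iff_of_true ((σ'.eq_block u hu.2.1 v hv.2.1).2 hb).1
        ((σ.eq_block u hu.2.1 v hv.2.1).2 hb).1
    · exact (h' u v hu hv hb).symm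
  refine ⟨fun c => ¬ ∀ u v, (G i).Reach c u → (G i).Reach c v → (σ'.le u v ↔ σ.le u v),
    fun c hc hflip => ⟨hc, fun u v hu hv huS hvS => ?_⟩, fun u v huv => ?_,
    fun u hu v hv => ⟨fun huv => ⟨fun hflip => ?_, fun hflip => ?_⟩, fun n => ?_⟩⟩
  · by_contra n
    exact reversed c hflip u v hu hv (fun h' => n (h'.of_isInduced (hsun.1 i) huS hvS))
      (h u v huS hvS n)
  · refine not_congr ⟨fun h' a b ha hb => h' a b (huv.trans ha) (huv.trans hb),
      fun h' a b ha hb => h' a b (huv.symm.trans ha) (huv.symm.trans hb)⟩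
  · by_cases hb : (G i).SameBlock u v
    · exact iff_of_true ((σ'.eq_block u hu v hv).2 hb).1 ((σ.eq_block u hu v hv).2 hb).2
    · have h1 := reversed u hflip u v (.refl hu) huv hb
      have h2 := σ.le_iff_not_le hu hv hb
      tauto
  · exact not_not.1 hflip u v (.refl hu) huv
  · have mem : ∀ {x}, x ∈ (G i).verts → x ∈ (unionGraph G).verts := fun hx =>
      Set.mem_iUnion.2 ⟨i, hx⟩
    obtain ⟨s, hs, hus⟩ := hsun.exists_shared_of_not_reach hu n (hconn u (mem hu) v (mem hv))
    obtain ⟨t, ht, hvt⟩ := hsun.exists_shared_of_not_reach hv (fun h => n h.symm)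
      (hconn v (mem hv) u (mem hu))
    rw [σ.le_iff_le_of_reach_of_reach hus hvt n, σ'.le_iff_le_of_reach_of_reach hus hvt n]
    refine (h s t hs ht fun hb => n ?_).symm
    exact hus.trans ((hb.reach_of_isInduced (hsun.1 i)).trans hvt.symm)

end Sunflower

/-- Given two simultaneous enumerations of a connected sunflower
proper interval graph, each straight enumeration of the second is obtained from the
corresponding one of the first, or from its reversal, through reversal of loose
components. -/
theorem simEnum_obtained_by_loose_reversals {V : Type u} [Fintype V] {k : ℕ}
    (G : Fin k → GraphOn V) (S : GraphOn V) (hsun : IsSunflower G S)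
    (hconn : ∀ u ∈ (unionGraph G).verts, ∀ v ∈ (unionGraph G).verts,
      Relation.ReflTransGen (unionGraph G).Adj u v)
    (hrep : HasSimProperRep G)
    (σ σ' : ∀ i, StraightEnum (G i))
    (hσ : IsSimEnum G S σ) (hσ' : IsSimEnum G S σ') :
    ∀ i, ObtainedByLooseReversals (G i) S (σ i).le (σ' i).le ∨
      ObtainedByLooseReversals (G i) S (fun a b => (σ i).le b a) (σ' i).le := by
  intro i
  obtain h | h := hσ.forall_le_iff_or_not hsun hconn hσ' i
  · exact Or.inl (hsun.obtainedByLooseReversals hconn (σ i) (σ' i) h)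
  · refine Or.inr (hsun.obtainedByLooseReversals hconn (σ i).reverse (σ' i)
      fun u v hu hv n => ?_)
    have hi := hsun.1 i
    have h1 := (σ i).le_iff_not_le (hi.1 hu) (hi.1 hv) fun h' => n (h'.of_isInduced hi hu hv)
    have h2 := h u v hu hv n
    change (σ i).le v u ↔ _
    tauto
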